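/- arXiv:2110.04608 — 3 statements merged into one kernel-verified Lean document; each statement's English description precedes it below -/
import Mathlib

section
/- For the Kerr–Newman–NUT–AdS metric (the Plebanski–Demianski solution with vanishing acceleration), the symmetric matrix field K(r,θ) = r²·g⁻¹(r,θ) + Δ_r(r)⁻¹·S(r)S(r)ᵀ − Δ_r(r)·E_rr, where S(r) ∈ ℝ⁴ has components S^t = s(r) = r² + a² − 2aCN + N², S^r = S^θ = 0, S^φ = a, and E_rr is the symmetric matrix whose only nonzero entry is the (r,r)-entry equal to 1, is a Killing tensor for g⁻¹: {H, F_K} = 0 identically on U × ℝ⁴. -/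
open Real

noncomputable section

/-- Partial derivative of a phase-space function with respect to the `μ`-th
position coordinate. -/
def pdx {n : ℕ} (μ : Fin n) (F : (Fin n → ℝ) × (Fin n → ℝ) → ℝ)
    (z : (Fin n → ℝ) × (Fin n → ℝ)) : ℝ :=
  deriv (fun s => F (Function.update z.1 μ s, z.2)) (z.1 μ)

/-- Partial derivative of a phase-space function with respect to the `μ`-th
momentum coordinate. -/
def pdp {n : ℕ} (μ : Fin n) (F : (Fin n → ℝ) × (Fin n → ℝ) → ℝ)
    (z : (Fin n → ℝ) × (Fin n → ℝ)) : ℝ :=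
  deriv (fun s => F (z.1, Function.update z.2 μ s)) (z.2 μ)

/-- Canonical Poisson bracket. -/
def poisson {n : ℕ} (A B : (Fin n → ℝ) × (Fin n → ℝ) → ℝ)
    (z : (Fin n → ℝ) × (Fin n → ℝ)) : ℝ :=
  ∑ μ : Fin n, (pdp μ A z * pdx μ B z - pdx μ A z * pdp μ B z)

/-- Quadratic momentum function of a matrix field depending on `(r,θ) = (x 1, x 2)`. -/
def quadF4 (K : ℝ → ℝ → Matrix (Fin 4) (Fin 4) ℝ)
    (z : (Fin 4 → ℝ) × (Fin 4 → ℝ)) : ℝ :=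
  ∑ μ : Fin 4, ∑ ν : Fin 4, K (z.1 1) (z.1 2) μ ν * z.2 μ * z.2 ν

/-- The matrix with only nonzero entry `1` at the `(r,r)` position. -/
def Err : Matrix (Fin 4) (Fin 4) ℝ :=
  Matrix.of ![![0,0,0,0], ![0,1,0,0], ![0,0,0,0], ![0,0,0,0]]

namespace KNNAdS

variable (M N a C Λ β₀ : ℝ)

def k : ℝ := (1 - Λ*N^2) * (a^2 - N^2)
def Δθ (θ : ℝ) : ℝ := 1 + (4*a*N*Λ/3) * Real.cos θ + (a^2*Λ/3) * (Real.cos θ)^2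
def Δr (r : ℝ) : ℝ :=
  (k N a Λ + β₀) - 2*M*r
    + (k N a Λ / (a^2 - N^2) - (a^2 + 3*N^2)*Λ/3) * r^2 - (Λ/3) * r^4
def Sig (r θ : ℝ) : ℝ := r^2 + (N + a * Real.cos θ)^2
def χ (θ : ℝ) : ℝ := a * (Real.sin θ)^2 - 2*N*(Real.cos θ + C)

/-- The Kerr–Newman–NUT–AdS metric (Plebanski–Demianski with vanishing
acceleration) in coordinates `(t,r,θ,φ)`. -/
def g (r θ : ℝ) : Matrix (Fin 4) (Fin 4) ℝ :=
  Matrix.of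
    ![![-(Δr M N a Λ β₀ r - a^2 * Δθ N a Λ θ * (Real.sin θ)^2) / Sig N a r θ,
        0, 0,
        (Δr M N a Λ β₀ r * χ N a C θ
          - a * (Sig N a r θ + a * χ N a C θ) * Δθ N a Λ θ * (Real.sin θ)^2)
          / Sig N a r θ],
      ![0, Sig N a r θ / Δr M N a Λ β₀ r, 0, 0],
      ![0, 0, Sig N a r θ / Δθ N a Λ θ, 0],
      ![(Δr M N a Λ β₀ r * χ N a C θ
          - a * (Sig N a r θ + a * χ N a C θ) * Δθ N a Λ θ * (Real.sin θ)^2)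
          / Sig N a r θ,
        0, 0,
        ((Sig N a r θ + a * χ N a C θ)^2 * Δθ N a Λ θ * (Real.sin θ)^2
          - Δr M N a Λ β₀ r * (χ N a C θ)^2) / Sig N a r θ]]

/-- The vector `S` with `S^t = s(r) = r² + a² − 2aCN + N²`, `S^φ = a`. -/
def S (r : ℝ) : Fin 4 → ℝ := ![r^2 + a^2 - 2*a*C*N + N^2, 0, 0, a]

end KNNAdS

namespace KNNAdS

/-- The radial part of the separated Hamiltonian. -/
def Rad (M N a C Λ β₀ : ℝ) (r : ℝ) (p : Fin 4 → ℝ) : ℝ :=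
  Δr M N a Λ β₀ r * (p 1)^2
    - (Δr M N a Λ β₀ r)⁻¹ * ((r^2 + a^2 - 2*a*C*N + N^2) * p 0 + a * p 3)^2

/-- The angular part of the separated Hamiltonian. -/
def Ang (N a C Λ : ℝ) (θ : ℝ) (p : Fin 4 → ℝ) : ℝ :=
  Δθ N a Λ θ * (p 2)^2
    + (Δθ N a Λ θ * (Real.sin θ)^2)⁻¹ * (χ N a C θ * p 0 + p 3)^2

/-- Explicit inverse metric. -/
def gi (M N a C Λ β₀ : ℝ) (r θ : ℝ) : Matrix (Fin 4) (Fin 4) ℝ :=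
  let s := r^2 + a^2 - 2*a*C*N + N^2
  let D := (Δr M N a Λ β₀ r)⁻¹
  let E := (Δθ N a Λ θ * (Real.sin θ)^2)⁻¹
  (Sig N a r θ)⁻¹ • Matrix.of
    ![![E * (χ N a C θ)^2 - D * s^2, 0, 0, E * χ N a C θ - D * s * a],
      ![0, Δr M N a Λ β₀ r, 0, 0],
      ![0, 0, Δθ N a Λ θ, 0],
      ![E * χ N a C θ - D * s * a, 0, 0, E - D * a^2]]

lemma sig_eq (N a C r θ : ℝ) :
    r^2 + a^2 - 2*a*C*N + N^2 = Sig N a r θ + a * χ N a C θ := by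
  have h := Real.sin_sq θ
  simp only [Sig, χ, h]
  ring

lemma g_inv (M N a C Λ β₀ r θ : ℝ) (h1 : Δr M N a Λ β₀ r ≠ 0) (h2 : Δθ N a Λ θ ≠ 0)
    (h3 : Sig N a r θ ≠ 0) (h4 : Real.sin θ ≠ 0) :
    (g M N a C Λ β₀ r θ)⁻¹ = gi M N a C Λ β₀ r θ := by
  apply Matrix.inv_eq_right_inv
  simp only [gi, sig_eq N a C r θ, g]
  generalize Δr M N a Λ β₀ r = D at *
  generalize Δθ N a Λ θ = E at *
  generalize Sig N a r θ = G at *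
  generalize χ N a C θ = X at *
  generalize Real.sin θ = s at *
  ext i j
  fin_cases i <;> fin_cases j <;>
    simp [Matrix.mul_apply, Fin.sum_univ_four] <;> field_simp <;> ring

lemma quad_inv (M N a C Λ β₀ : ℝ) (x p : Fin 4 → ℝ) (h1 : Δr M N a Λ β₀ (x 1) ≠ 0)
    (h2 : Δθ N a Λ (x 2) ≠ 0)
    (h3 : Sig N a (x 1) (x 2) ≠ 0) (h4 : Real.sin (x 2) ≠ 0) :
    quadF4 (fun r θ => (g M N a C Λ β₀ r θ)⁻¹) (x, p) =
      (Rad M N a C Λ β₀ (x 1) p + Ang N a C Λ (x 2) p) / Sig N a (x 1) (x 2) := by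
  simp only [quadF4, g_inv M N a C Λ β₀ _ _ h1 h2 h3 h4, gi, Rad, Ang]
  simp [Fin.sum_univ_four]
  ring

lemma quad_K (M N a C Λ β₀ : ℝ) (z : (Fin 4 → ℝ) × (Fin 4 → ℝ)) :
    quadF4 (fun r θ => (r^2) • (g M N a C Λ β₀ r θ)⁻¹
        + (Δr M N a Λ β₀ r)⁻¹ • Matrix.vecMulVec (S N a C r) (S N a C r)
        - Δr M N a Λ β₀ r • Err) z
      = (z.1 1)^2 * quadF4 (fun r θ => (g M N a C Λ β₀ r θ)⁻¹) z
        - Rad M N a C Λ β₀ (z.1 1) z.2 := by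
  simp only [quadF4, Rad]
  generalize (g M N a C Λ β₀ (z.1 1) (z.1 2))⁻¹ = A
  simp [Fin.sum_univ_four, Err, S]
  ring

lemma rad_diff_r (M N a C Λ β₀ r : ℝ) (p : Fin 4 → ℝ) (h1 : Δr M N a Λ β₀ r ≠ 0) :
    DifferentiableAt ℝ (fun s => Rad M N a C Λ β₀ s p) r := by
  have hD : DifferentiableAt ℝ (fun s => Δr M N a Λ β₀ s) r := by
    unfold Δr; fun_prop
  unfold Rad
  exact (hD.mul_const _).sub ((hD.inv h1).mul (by fun_prop))

lemma delta_cont (M N a Λ β₀ : ℝ) : Continuous (fun s => Δr M N a Λ β₀ s) := by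
  unfold Δr; fun_prop

lemma sig_cont (N a θ : ℝ) : Continuous (fun s => Sig N a s θ) := by
  unfold Sig; fun_prop

end KNNAdS

/-- The field `K = r²·g⁻¹ + Δ_r⁻¹·SSᵀ − Δ_r·E_rr` is a Killing
tensor for the Kerr–Newman–NUT–AdS metric: `{H, F_K} = 0` on `U × ℝ⁴`. -/
theorem kerr_newman_nut_ads_killing_tensor
    (M N a C Λ β₀ : ℝ) (haN : a^2 ≠ N^2) :
    ∀ x : Fin 4 → ℝ,
      KNNAdS.Δr M N a Λ β₀ (x 1) ≠ 0 →
      KNNAdS.Δθ N a Λ (x 2) ≠ 0 →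
      KNNAdS.Sig N a (x 1) (x 2) ≠ 0 →
      Real.sin (x 2) ≠ 0 →
      (KNNAdS.g M N a C Λ β₀ (x 1) (x 2)).det ≠ 0 →
      ∀ p : Fin 4 → ℝ,
        poisson
          (quadF4 (fun r θ => (KNNAdS.g M N a C Λ β₀ r θ)⁻¹))
          (quadF4 (fun r θ =>
            (r^2) • (KNNAdS.g M N a C Λ β₀ r θ)⁻¹
              + (KNNAdS.Δr M N a Λ β₀ r)⁻¹ •
                  Matrix.vecMulVec (KNNAdS.S N a C r) (KNNAdS.S N a C r)
              - KNNAdS.Δr M N a Λ β₀ r • Err))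
          (x, p) = 0 := by
  intro x h1 h2 h3 h4 _ p
  have hK := funext (KNNAdS.quad_K M N a C Λ β₀)
  rw [hK]
  have hH := fun (y q : Fin 4 → ℝ) => KNNAdS.quad_inv M N a C Λ β₀ y q
  have hconst : ∀ (i : Fin 4), i ≠ 1 → i ≠ 2 → ∀ s,
      quadF4 (fun r θ => (KNNAdS.g M N a C Λ β₀ r θ)⁻¹) (Function.update x i s, p) =
      quadF4 (fun r θ => (KNNAdS.g M N a C Λ β₀ r θ)⁻¹) (x, p) := by
    intro i hi1 hi2 s
    simp only [quadF4, Function.update_of_ne hi1.symm, Function.update_of_ne hi2.symm]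
  generalize quadF4 (fun r θ => (KNNAdS.g M N a C Λ β₀ r θ)⁻¹) = H at *
  have hx0 : ∀ (i : Fin 4), i ≠ 1 → i ≠ 2 → pdx i H (x, p) = 0 := by
    intro i hi1 hi2
    simp only [pdx, hconst i hi1 hi2, deriv_const]
  have hx0' : ∀ (i : Fin 4), i ≠ 1 → i ≠ 2 →
      pdx i (fun z => (z.1 1)^2 * H z - KNNAdS.Rad M N a C Λ β₀ (z.1 1) z.2) (x, p) = 0 := by
    intro i hi1 hi2
    simp only [pdx, hconst i hi1 hi2, Function.update_of_ne hi1.symm, deriv_const]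
  have hx2 : pdx 2 (fun z => (z.1 1)^2 * H z - KNNAdS.Rad M N a C Λ β₀ (z.1 1) z.2) (x, p)
      = (x 1)^2 * pdx 2 H (x, p) := by
    have h12 : (1 : Fin 4) ≠ 2 := by decide
    simp only [pdx, Function.update_of_ne h12, deriv_sub_const_fun, deriv_const_mul_field']
  have hp2 : pdp 2 (fun z => (z.1 1)^2 * H z - KNNAdS.Rad M N a C Λ β₀ (z.1 1) z.2) (x, p)
      = (x 1)^2 * pdp 2 H (x, p) := by
    have h12 : (1 : Fin 4) ≠ 2 := by decide
    have h02 : (0 : Fin 4) ≠ 2 := by decide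
    have h32 : (3 : Fin 4) ≠ 2 := by decide
    simp only [pdp, KNNAdS.Rad, Function.update_of_ne h12, Function.update_of_ne h02,
      Function.update_of_ne h32, deriv_sub_const_fun, deriv_const_mul_field']
  have hRp : HasDerivAt (fun s => KNNAdS.Rad M N a C Λ β₀ (x 1) (Function.update p 1 s))
      (2 * KNNAdS.Δr M N a Λ β₀ (x 1) * p 1) (p 1) := by
    have h01 : (0 : Fin 4) ≠ 1 := by decide
    have h31 : (3 : Fin 4) ≠ 1 := by decide
    simp only [KNNAdS.Rad, Function.update_of_ne h01, Function.update_of_ne h31,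
      Function.update_self]
    have := (((hasDerivAt_id (p 1)).pow 2).const_mul
      (KNNAdS.Δr M N a Λ β₀ (x 1))).sub_const ((KNNAdS.Δr M N a Λ β₀ (x 1))⁻¹ *
        (((x 1)^2 + a^2 - 2*a*C*N + N^2) * p 0 + a * p 3)^2)
    refine this.congr_deriv ?_
    simp; ring
  have hHp : HasDerivAt (fun s => H (x, Function.update p 1 s))
      (2 * KNNAdS.Δr M N a Λ β₀ (x 1) * p 1 / KNNAdS.Sig N a (x 1) (x 2)) (p 1) := by
    have h01 : (0 : Fin 4) ≠ 1 := by decide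
    have h21 : (2 : Fin 4) ≠ 1 := by decide
    have h31 : (3 : Fin 4) ≠ 1 := by decide
    simp only [hH x _ h1 h2 h3 h4]
    have hA : ∀ s, KNNAdS.Ang N a C Λ (x 2) (Function.update p 1 s)
        = KNNAdS.Ang N a C Λ (x 2) p := by
      intro s
      simp only [KNNAdS.Ang, Function.update_of_ne h01, Function.update_of_ne h21,
        Function.update_of_ne h31]
    simp only [hA]
    exact (hRp.add_const _).div_const _
  have hp1 : pdp 1 H (x, p)
      = 2 * KNNAdS.Δr M N a Λ β₀ (x 1) * p 1 / KNNAdS.Sig N a (x 1) (x 2) := hHp.deriv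
  have hp1' : pdp 1 (fun z => (z.1 1)^2 * H z - KNNAdS.Rad M N a C Λ β₀ (z.1 1) z.2) (x, p)
      = (x 1)^2 * (2 * KNNAdS.Δr M N a Λ β₀ (x 1) * p 1 / KNNAdS.Sig N a (x 1) (x 2))
        - 2 * KNNAdS.Δr M N a Λ β₀ (x 1) * p 1 := ((hHp.const_mul ((x 1)^2)).sub hRp).deriv
  obtain ⟨R', hR'⟩ : ∃ R', HasDerivAt (fun s => KNNAdS.Rad M N a C Λ β₀ s p) R' (x 1) :=
    ⟨_, (KNNAdS.rad_diff_r M N a C Λ β₀ (x 1) p h1).hasDerivAt⟩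
  have hS : HasDerivAt (fun s => KNNAdS.Sig N a s (x 2)) (2 * x 1) (x 1) := by
    unfold KNNAdS.Sig
    refine (((hasDerivAt_id (x 1)).pow 2).add_const _).congr_deriv ?_
    simp
  have hev : (fun s => H (Function.update x 1 s, p)) =ᶠ[nhds (x 1)] fun s =>
      (KNNAdS.Rad M N a C Λ β₀ s p + KNNAdS.Ang N a C Λ (x 2) p) / KNNAdS.Sig N a s (x 2) := by
    filter_upwards [(KNNAdS.delta_cont M N a Λ β₀).continuousAt.eventually_ne h1,
      (KNNAdS.sig_cont N a (x 2)).continuousAt.eventually_ne h3] with s hs1 hs3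
    have h21 : (2 : Fin 4) ≠ 1 := by decide
    have := hH (Function.update x 1 s) p
    simp only [Function.update_self, Function.update_of_ne h21] at this
    exact this hs1 h2 hs3 h4
  have hHr := ((hR'.add_const (KNNAdS.Ang N a C Λ (x 2) p)).div hS h3).congr_of_eventuallyEq hev
  have hx1 : pdx 1 H (x, p) = _ := hHr.deriv
  have hKr := (((hasDerivAt_id (x 1)).pow 2).mul hHr).sub hR'
  have hx1' : pdx 1 (fun z => (z.1 1)^2 * H z - KNNAdS.Rad M N a C Λ β₀ (z.1 1) z.2) (x, p)
      = deriv (((id ^ 2 : ℝ → ℝ) * fun s => H (Function.update x 1 s, p))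
          - fun s => KNNAdS.Rad M N a C Λ β₀ s p) (x 1) := by
    simp only [pdx, Function.update_self]
    rfl
  rw [hKr.deriv] at hx1'
  have hval := hH x p h1 h2 h3 h4
  simp only [poisson, Fin.sum_univ_four, hx0 0 (by decide) (by decide),
    hx0 3 (by decide) (by decide), hx0' 0 (by decide) (by decide),
    hx0' 3 (by decide) (by decide), hx2, hp2, hp1, hp1', hx1, hx1']
  simp only [Function.update_eq_self, hval, Pi.pow_apply, id]
  field_simp
  ring
end
end

section
/- For the Gal'tsov–Kechkin (EMDA dyonic Kerr–NUT) metric, the symmetric matrix field K(r,θ) = r(r − r₋)·g⁻¹(r,θ) + Δ(r)⁻¹·S(r)S(r)ᵀ − Δ(r)·E_rr, where S(r) ∈ ℝ⁴ has components S^t = s(r) = r(r − r₋) + a² + N² − N₋², S^r = S^θ = 0, S^φ = a, and E_rr is the symmetric matrix whose only nonzero entry is the (r,r)-entry equal to 1, is a Killing tensor for g⁻¹: {H, F_K} = 0 identically on U × ℝ⁴. -/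
open Real

noncomputable section

namespace GK

variable (M N a Q P : ℝ)

def rm : ℝ := M * (Q^2 + P^2) / (M^2 + N^2)
def Nm : ℝ := N * (Q^2 + P^2) / (2 * (M^2 + N^2))
def Δ (r : ℝ) : ℝ :=
  (r - rm M N Q P) * (r - 2*M) + a^2 - (N - Nm M N Q P)^2
def Sig (r θ : ℝ) : ℝ :=
  r * (r - rm M N Q P) + (a * Real.cos θ + N)^2 - (Nm M N Q P)^2
def w (r θ : ℝ) : ℝ :=
  N * Δ M N a Q P r * Real.cos θ
    + a * (Real.sin θ)^2 * (M * (r - rm M N Q P) + N * (N - Nm M N Q P))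
def ω (r θ : ℝ) : ℝ :=
  -(2 * w M N a Q P r θ) / (Δ M N a Q P r - a^2 * (Real.sin θ)^2)
def f (r θ : ℝ) : ℝ :=
  (Δ M N a Q P r - a^2 * (Real.sin θ)^2) / Sig M N a Q P r θ

/-- The Gal'tsov–Kechkin (EMDA dyonic Kerr–NUT) metric in coordinates
`(t,r,θ,φ)`. -/
def g (r θ : ℝ) : Matrix (Fin 4) (Fin 4) ℝ :=
  Matrix.of
    ![![-(f M N a Q P r θ), 0, 0, f M N a Q P r θ * ω M N a Q P r θ],
      ![0, Sig M N a Q P r θ / Δ M N a Q P r, 0, 0],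
      ![0, 0, Sig M N a Q P r θ, 0],
      ![f M N a Q P r θ * ω M N a Q P r θ, 0, 0,
        Sig M N a Q P r θ * Δ M N a Q P r * (Real.sin θ)^2
            / (Δ M N a Q P r - a^2 * (Real.sin θ)^2)
          - f M N a Q P r θ * (ω M N a Q P r θ)^2]]

/-- The vector `S` with `S^t = s(r) = r(r−r₋) + a² + N² − N₋²`, `S^φ = a`. -/
def S (r : ℝ) : Fin 4 → ℝ :=
  ![r * (r - rm M N Q P) + a^2 + N^2 - (Nm M N Q P)^2, 0, 0, a]

end GK

namespace GK

/-- Radial part of `Σ H`. -/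
def AA (M N a Q P r : ℝ) (p : Fin 4 → ℝ) : ℝ :=
  Δ M N a Q P r * p 1 ^ 2
    - (S M N a Q P r 0 * p 0 + a * p 3) ^ 2 / Δ M N a Q P r

/-- Angular part of `Σ H`. -/
def BB (N a θ : ℝ) (p : Fin 4 → ℝ) : ℝ :=
  p 2 ^ 2
    + ((a * Real.sin θ ^ 2 - 2 * N * Real.cos θ) * p 0 + p 3) ^ 2 / Real.sin θ ^ 2

/-- The explicit inverse metric. -/
def ginv (M N a Q P r θ : ℝ) : Matrix (Fin 4) (Fin 4) ℝ :=
  Matrix.of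
    ![![-(f M N a Q P r θ)⁻¹
          + (Δ M N a Q P r - a^2 * (Real.sin θ)^2) * (ω M N a Q P r θ) ^ 2
            / (Sig M N a Q P r θ * Δ M N a Q P r * (Real.sin θ)^2), 0, 0,
        (Δ M N a Q P r - a^2 * (Real.sin θ)^2) * (ω M N a Q P r θ)
            / (Sig M N a Q P r θ * Δ M N a Q P r * (Real.sin θ)^2)],
      ![0, Δ M N a Q P r / Sig M N a Q P r θ, 0, 0],
      ![0, 0, (Sig M N a Q P r θ)⁻¹, 0],
      ![(Δ M N a Q P r - a^2 * (Real.sin θ)^2) * (ω M N a Q P r θ)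
            / (Sig M N a Q P r θ * Δ M N a Q P r * (Real.sin θ)^2), 0, 0,
        (Δ M N a Q P r - a^2 * (Real.sin θ)^2)
            / (Sig M N a Q P r θ * Δ M N a Q P r * (Real.sin θ)^2)]]

theorem g_inv_eq (M N a Q P r θ : ℝ) (hΔ : Δ M N a Q P r ≠ 0)
    (hS : Sig M N a Q P r θ ≠ 0) (hs : Real.sin θ ≠ 0)
    (hD : Δ M N a Q P r - a^2 * (Real.sin θ)^2 ≠ 0) :
    (g M N a Q P r θ)⁻¹ = ginv M N a Q P r θ := by
  apply Matrix.inv_eq_right_inv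
  unfold g ginv f
  generalize ω M N a Q P r θ = o
  generalize Real.sin θ = s at *
  generalize Δ M N a Q P r = d at *
  generalize Sig M N a Q P r θ = σ at *
  generalize hE : d - a^2 * s^2 = E at *
  ext i j
  fin_cases i <;> fin_cases j <;>
    simp [Matrix.mul_apply, Fin.sum_univ_four] <;> field_simp <;> ring

theorem quad_eq (M N a Q P r θ : ℝ) (hΔ : Δ M N a Q P r ≠ 0)
    (hS : Sig M N a Q P r θ ≠ 0) (hs : Real.sin θ ≠ 0)
    (hD : Δ M N a Q P r - a^2 * (Real.sin θ)^2 ≠ 0) (p : Fin 4 → ℝ) :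
    (∑ μ : Fin 4, ∑ ν : Fin 4, (g M N a Q P r θ)⁻¹ μ ν * p μ * p ν)
      = (AA M N a Q P r p + BB N a θ p) / Sig M N a Q P r θ := by
  rw [g_inv_eq M N a Q P r θ hΔ hS hs hD]
  have h1 : 2 * w M N a Q P r θ = a * Real.sin θ ^ 2 * S M N a Q P r 0
      - Δ M N a Q P r * (a * Real.sin θ ^ 2 - 2 * N * Real.cos θ) := by
    simp only [w, S, Δ, Matrix.cons_val_zero]; ring
  have h2 : Sig M N a Q P r θ = S M N a Q P r 0
      - a * (a * Real.sin θ ^ 2 - 2 * N * Real.cos θ) := by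
    simp only [Sig, S, Matrix.cons_val_zero]
    have := Real.sin_sq_add_cos_sq θ
    linear_combination a^2 * this
  simp only [ginv, ω, f, AA, BB, h1, Fin.sum_univ_four]
  simp
  generalize a * Real.sin θ ^ 2 - 2 * N * Real.cos θ = T at *
  generalize S M N a Q P r 0 = s0 at *
  generalize Real.sin θ = s at *
  generalize Δ M N a Q P r = d at *
  generalize Sig M N a Q P r θ = σ at *
  have key : -σ^2 * d * s^2 + (a * s^2 * s0 - d * T)^2
      = (d - a^2*s^2) * (d * T^2 - s0^2 * s^2) := by rw [h2]; ring
  have e : -(σ / (d - a^2*s^2)) + (d - a^2*s^2) * (-(a * s^2 * s0 - d * T) / (d - a^2*s^2))^2 / (σ * d * s^2) = (d * T^2 - s0^2 * s^2) / (σ * d * s^2) := by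
    generalize hE : d - a^2 * s^2 = E at *
    field_simp
    linear_combination key
  have e2 : (d - a^2*s^2) * (-(a * s^2 * s0 - d * T) / (d - a^2*s^2)) / (σ * d * s^2)
      = -(a * s^2 * s0 - d * T) / (σ * d * s^2) := by
    rw [mul_div_cancel₀ _ hD]
  simp only [neg_sub] at *
  rw [e, e2]
  field_simp
  ring

theorem quadK_eq (M N a Q P r θ : ℝ) (p : Fin 4 → ℝ) :
    (∑ μ : Fin 4, ∑ ν : Fin 4, ((r * (r - GK.rm M N Q P)) • (GK.g M N a Q P r θ)⁻¹
              + (GK.Δ M N a Q P r)⁻¹ •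
                  Matrix.vecMulVec (GK.S M N a Q P r) (GK.S M N a Q P r)
              - GK.Δ M N a Q P r • Err) μ ν * p μ * p ν)
      = r * (r - rm M N Q P) * (∑ μ : Fin 4, ∑ ν : Fin 4, (g M N a Q P r θ)⁻¹ μ ν * p μ * p ν)
        - AA M N a Q P r p := by
  generalize (g M N a Q P r θ)⁻¹ = G
  simp only [Fin.sum_univ_four, AA, Matrix.add_apply, Matrix.sub_apply, Matrix.smul_apply,
    Matrix.vecMulVec_apply, Err, S, smul_eq_mul]
  simp
  ring

theorem cont_Δ (M N a Q P : ℝ) : Differentiable ℝ (Δ M N a Q P) := by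
  unfold Δ; fun_prop

theorem bracket (M N a Q P : ℝ) (x p : Fin 4 → ℝ)
    (hΔ : Δ M N a Q P (x 1) ≠ 0)
    (hS : Sig M N a Q P (x 1) (x 2) ≠ 0)
    (hs : Real.sin (x 2) ≠ 0)
    (hD : Δ M N a Q P (x 1) - a^2 * (Real.sin (x 2))^2 ≠ 0)
    (H F : (Fin 4 → ℝ) × (Fin 4 → ℝ) → ℝ)
    (hH : ∀ x p : Fin 4 → ℝ, Δ M N a Q P (x 1) ≠ 0 → Sig M N a Q P (x 1) (x 2) ≠ 0 →
      Real.sin (x 2) ≠ 0 → Δ M N a Q P (x 1) - a^2 * (Real.sin (x 2))^2 ≠ 0 →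
      H (x, p) = (AA M N a Q P (x 1) p + BB N a (x 2) p) / Sig M N a Q P (x 1) (x 2))
    (hF : ∀ x p : Fin 4 → ℝ,
      F (x, p) = x 1 * (x 1 - rm M N Q P) * H (x, p) - AA M N a Q P (x 1) p)
    (hHx : ∀ x y p : Fin 4 → ℝ, x 1 = y 1 → x 2 = y 2 → H (x, p) = H (y, p)) :
    poisson H F (x, p) = 0 := by
  have hc := (cont_Δ M N a Q P).continuous
  have hSr : Continuous (fun s => Sig M N a Q P s (x 2)) := by unfold Sig; fun_prop
  have hSθ : Continuous (fun s => Sig M N a Q P (x 1) s) := by unfold Sig; fun_prop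
  -- trivial directions
  have t0 : ∀ μ : Fin 4, μ ≠ 1 → μ ≠ 2 → pdx μ H (x, p) = 0 ∧ pdx μ F (x, p) = 0 := by
    intro μ h1 h2
    have e : ∀ s, H (Function.update x μ s, p) = H (x, p) := fun s =>
      hHx _ _ _ (Function.update_of_ne h1.symm _ _) (Function.update_of_ne h2.symm _ _)
    constructor
    · simp [pdx, e]
    · simp [pdx, hF, e, Function.update_of_ne h1.symm]
  -- r direction
  obtain ⟨Ad, hAd⟩ : ∃ Ad, HasDerivAt (fun s => AA M N a Q P s p) Ad (x 1) := by
    have : DifferentiableAt ℝ (fun s => AA M N a Q P s p) (x 1) := by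
      have h1 := (cont_Δ M N a Q P) (x 1)
      have h2 : DifferentiableAt ℝ (fun s => S M N a Q P s 0) (x 1) := by
        simp only [S, Matrix.cons_val_zero]; fun_prop
      unfold AA
      fun_prop (disch := assumption)
    exact ⟨_, this.hasDerivAt⟩
  obtain ⟨Bd, hBd⟩ : ∃ Bd, HasDerivAt (fun s => BB N a s p) Bd (x 2) := by
    have : DifferentiableAt ℝ (fun s => BB N a s p) (x 2) := by
      unfold BB
      fun_prop (disch := simpa using hs)
    exact ⟨_, this.hasDerivAt⟩
  obtain ⟨rhod, hrho⟩ : ∃ rhod, HasDerivAt (fun s => s * (s - rm M N Q P)) rhod (x 1) := by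
    have : DifferentiableAt ℝ (fun s => s * (s - rm M N Q P)) (x 1) := by fun_prop
    exact ⟨_, this.hasDerivAt⟩
  obtain ⟨kapd, hkap⟩ : ∃ kapd, HasDerivAt (fun s => Sig M N a Q P (x 1) s) kapd (x 2) := by
    have : DifferentiableAt ℝ (fun s => Sig M N a Q P (x 1) s) (x 2) := by
      unfold Sig; fun_prop
    exact ⟨_, this.hasDerivAt⟩
  have hsig : HasDerivAt (fun s => Sig M N a Q P s (x 2)) rhod (x 1) := by
    unfold Sig
    exact (hrho.add_const _).sub_const _
  have hHr : HasDerivAt (fun s => H (Function.update x 1 s, p))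
      ((Ad * Sig M N a Q P (x 1) (x 2)
        - (AA M N a Q P (x 1) p + BB N a (x 2) p) * rhod) / Sig M N a Q P (x 1) (x 2) ^ 2)
      (x 1) := by
    refine ((hAd.add_const (BB N a (x 2) p)).div hsig hS).congr_of_eventuallyEq ?_
    filter_upwards [hc.continuousAt.eventually_ne hΔ, hSr.continuousAt.eventually_ne hS,
      (hc.sub continuous_const).continuousAt.eventually_ne hD] with s h1 h2 h3
    have := hH (Function.update x 1 s) p
    simp at this
    rw [this h1 h2 hs h3]; rfl
  have hHθ : HasDerivAt (fun s => H (Function.update x 2 s, p))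
      ((Bd * Sig M N a Q P (x 1) (x 2)
        - (AA M N a Q P (x 1) p + BB N a (x 2) p) * kapd) / Sig M N a Q P (x 1) (x 2) ^ 2)
      (x 2) := by
    refine ((hBd.const_add (AA M N a Q P (x 1) p)).div hkap hS).congr_of_eventuallyEq ?_
    have c4 : Continuous (fun s : ℝ => Δ M N a Q P (x 1) - a^2 * (Real.sin s)^2) := by fun_prop
    filter_upwards [Real.continuous_sin.continuousAt.eventually_ne hs,
      hSθ.continuousAt.eventually_ne hS,
      c4.continuousAt.eventually_ne hD] with s h1 h2 h3
    have := hH (Function.update x 2 s) p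
    simp at this
    rw [this hΔ h2 h1 h3]; rfl
  have xr : Function.update x 1 (x 1) = x := Function.update_eq_self _ _
  have hFr := ((hrho.mul hHr).sub hAd).congr_of_eventuallyEq
    (f₁ := (fun s => F (Function.update x 1 s, p)))
    (Filter.Eventually.of_forall (fun s => by simp [hF]))
  have hFθ := ((hHθ.const_mul (x 1 * (x 1 - rm M N Q P))).sub_const
      (AA M N a Q P (x 1) p)).congr_of_eventuallyEq
    (f₁ := (fun s => F (Function.update x 2 s, p)))
    (Filter.Eventually.of_forall (fun s => by simp [hF]))
  -- momentum derivatives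
  have hAp : HasDerivAt (fun s => AA M N a Q P (x 1) (Function.update p 1 s))
      (Δ M N a Q P (x 1) * (2 * p 1)) (p 1) := by
    unfold AA
    simp
    simpa using ((hasDerivAt_pow 2 (p 1)).const_mul (Δ M N a Q P (x 1)))
  have hBp : HasDerivAt (fun s => BB N a (x 2) (Function.update p 2 s))
      (2 * p 2) (p 2) := by
    unfold BB
    simp
    simpa using (hasDerivAt_pow 2 (p 2))
  have hHp1 : HasDerivAt (fun s => H (x, Function.update p 1 s))
      (Δ M N a Q P (x 1) * (2 * p 1) / Sig M N a Q P (x 1) (x 2)) (p 1) := by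
    refine ((hAp.add_const (BB N a (x 2) p)).div_const _).congr_of_eventuallyEq
      (Filter.Eventually.of_forall ?_)
    intro s
    simp only [hH x _ hΔ hS hs hD]
    simp [BB]
  have hHp2 : HasDerivAt (fun s => H (x, Function.update p 2 s))
      (2 * p 2 / Sig M N a Q P (x 1) (x 2)) (p 2) := by
    refine ((hBp.const_add (AA M N a Q P (x 1) p)).div_const _).congr_of_eventuallyEq
      (Filter.Eventually.of_forall ?_)
    intro s
    simp only [hH x _ hΔ hS hs hD]
    simp [AA]
  have hFp1 := ((hHp1.const_mul (x 1 * (x 1 - rm M N Q P))).sub hAp).congr_of_eventuallyEq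
    (f₁ := (fun s => F (x, Function.update p 1 s)))
    (Filter.Eventually.of_forall (fun s => by simp [hF]))
  have hFp2 := ((hHp2.const_mul (x 1 * (x 1 - rm M N Q P))).sub_const
      (AA M N a Q P (x 1) p)).congr_of_eventuallyEq
    (f₁ := (fun s => F (x, Function.update p 2 s)))
    (Filter.Eventually.of_forall (fun s => by simp [hF, AA]))
  have d1 : pdx 1 H (x, p) = _ := hHr.deriv
  have d2 : pdx 2 H (x, p) = _ := hHθ.deriv
  have d3 : pdx 1 F (x, p) = _ := hFr.deriv
  have d4 : pdx 2 F (x, p) = _ := hFθ.deriv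
  have d5 : pdp 1 H (x, p) = _ := hHp1.deriv
  have d6 : pdp 2 H (x, p) = _ := hHp2.deriv
  have d7 : pdp 1 F (x, p) = _ := hFp1.deriv
  have d8 : pdp 2 F (x, p) = _ := hFp2.deriv
  unfold poisson
  rw [Fin.sum_univ_four, (t0 0 (by decide) (by decide)).1, (t0 0 (by decide) (by decide)).2,
    (t0 3 (by decide) (by decide)).1, (t0 3 (by decide) (by decide)).2,
    d1, d2, d3, d4, d5, d6, d7, d8, xr, hH x p hΔ hS hs hD]
  field_simp
  ring

end GK

/-- The field `K = r(r−r₋)·g⁻¹ + Δ⁻¹·SSᵀ − Δ·E_rr` is a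
Killing tensor for the Gal'tsov–Kechkin metric: `{H, F_K} = 0` on `U × ℝ⁴`. -/
theorem galtsov_kechkin_killing_tensor
    (M N a Q P : ℝ) (hMN : M^2 + N^2 ≠ 0) :
    ∀ x : Fin 4 → ℝ,
      GK.Δ M N a Q P (x 1) ≠ 0 →
      GK.Sig M N a Q P (x 1) (x 2) ≠ 0 →
      Real.sin (x 2) ≠ 0 →
      GK.Δ M N a Q P (x 1) - a^2 * (Real.sin (x 2))^2 ≠ 0 →
      ∀ p : Fin 4 → ℝ,
        poisson
          (quadF4 (fun r θ => (GK.g M N a Q P r θ)⁻¹))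
          (quadF4 (fun r θ =>
            (r * (r - GK.rm M N Q P)) • (GK.g M N a Q P r θ)⁻¹
              + (GK.Δ M N a Q P r)⁻¹ •
                  Matrix.vecMulVec (GK.S M N a Q P r) (GK.S M N a Q P r)
              - GK.Δ M N a Q P r • Err))
          (x, p) = 0 := by
  intro x hΔ hS hs hD p
  refine GK.bracket M N a Q P x p hΔ hS hs hD _ _ ?_ ?_ ?_
  · intro x p h1 h2 h3 h4
    exact GK.quad_eq M N a Q P (x 1) (x 2) h1 h2 h3 h4 p
  · intro x p
    exact GK.quadK_eq M N a Q P (x 1) (x 2) p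
  · intro x y p h1 h2
    simp only [quadF4, h1, h2]
end
end

section
/- For the Kerr–Sen metric of heterotic string theory, the symmetric matrix field K(r,θ) = r(r − r₋)·g⁻¹(r,θ) + Δ(r)⁻¹·S(r)S(r)ᵀ − Δ(r)·E_rr, where S(r) ∈ ℝ⁴ has components S^t = s(r) = r(r − r₋) + a², S^r = S^θ = 0, S^φ = a, and E_rr is the symmetric matrix whose only nonzero entry is the (r,r)-entry equal to 1, is a Killing tensor for g⁻¹: {H, F_K} = 0 identically on U × ℝ⁴. -/
open Real

noncomputable section

namespace KerrSen

variable (M a Q : ℝ)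

def rm : ℝ := Q^2 / M
def Δ (r : ℝ) : ℝ := (r - rm M Q) * (r - 2*M) + a^2
def Sig (r θ : ℝ) : ℝ := r * (r - rm M Q) + a^2 * (Real.cos θ)^2
def ω (r θ : ℝ) : ℝ :=
  -(2*a*M*(r - rm M Q) * (Real.sin θ)^2) / (Δ M a Q r - a^2 * (Real.sin θ)^2)
def f (r θ : ℝ) : ℝ :=
  (Δ M a Q r - a^2 * (Real.sin θ)^2) / Sig M a Q r θ

/-- The Kerr–Sen metric of heterotic string theory in coordinates `(t,r,θ,φ)`. -/
def g (r θ : ℝ) : Matrix (Fin 4) (Fin 4) ℝ :=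
  Matrix.of
    ![![-(f M a Q r θ), 0, 0, f M a Q r θ * ω M a Q r θ],
      ![0, Sig M a Q r θ / Δ M a Q r, 0, 0],
      ![0, 0, Sig M a Q r θ, 0],
      ![f M a Q r θ * ω M a Q r θ, 0, 0,
        Sig M a Q r θ * Δ M a Q r * (Real.sin θ)^2
            / (Δ M a Q r - a^2 * (Real.sin θ)^2)
          - f M a Q r θ * (ω M a Q r θ)^2]]

/-- The vector `S` with `S^t = s(r) = r(r−r₋) + a²`, `S^φ = a`. -/
def S (r : ℝ) : Fin 4 → ℝ := ![r * (r - rm M Q) + a^2, 0, 0, a]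

end KerrSen

namespace KerrSen

/-- Explicit inverse metric. -/
def gi (M a Q r θ : ℝ) : Matrix (Fin 4) (Fin 4) ℝ :=
  let s := r * (r - rm M Q) + a^2
  let D := Δ M a Q r
  let G := Sig M a Q r θ
  let w := (Real.sin θ)^2
  Matrix.of
    ![![(a^2 * w - s^2 / D) / G, 0, 0, (a - s * a / D) / G],
      ![0, D / G, 0, 0],
      ![0, 0, 1 / G, 0],
      ![(a - s * a / D) / G, 0, 0, (1 / w - a^2 / D) / G]]

/-- The open set on which everything is regular. -/
def Good (M a Q r θ : ℝ) : Prop :=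
  Δ M a Q r ≠ 0 ∧ Sig M a Q r θ ≠ 0 ∧ Real.sin θ ≠ 0 ∧
    Δ M a Q r - a^2 * (Real.sin θ)^2 ≠ 0

lemma g_inv (M a Q r θ : ℝ) (h : Good M a Q r θ) : (g M a Q r θ)⁻¹ = gi M a Q r θ := by
  obtain ⟨hD, hG, hs, hE⟩ := h
  apply Matrix.inv_eq_right_inv
  have h1 : 2 * a * M * (r - rm M Q) * (Real.sin θ)^2
      = a * (Sig M a Q r θ + a^2 * (Real.sin θ)^2 - Δ M a Q r) * (Real.sin θ)^2 := by
    have := Real.sin_sq_add_cos_sq θ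
    simp only [Sig, Δ]
    linear_combination -(a * a^2 * Real.sin θ ^ 2) * this
  have h2 : r * (r - rm M Q) + a^2 = Sig M a Q r θ + a^2 * (Real.sin θ)^2 := by
    have := Real.sin_sq_add_cos_sq θ
    simp only [Sig]
    linear_combination -(a^2) * this
  simp only [g, gi, f, ω, h1, h2]
  generalize Sig M a Q r θ = G at *
  generalize Δ M a Q r = D at *
  generalize Real.sin θ = w at *
  ext i j
  fin_cases i <;> fin_cases j <;>
    simp [Matrix.mul_apply, Fin.sum_univ_four] <;> field_simp <;> ring

/-- Radial part. -/
def Rad (M a Q : ℝ) (p : Fin 4 → ℝ) (r : ℝ) : ℝ :=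
  Δ M a Q r * p 1 ^ 2 - ((r * (r - rm M Q) + a^2) * p 0 + a * p 3)^2 / Δ M a Q r

/-- Angular part. -/
def Ang (a : ℝ) (p : Fin 4 → ℝ) (θ : ℝ) : ℝ :=
  p 2 ^ 2 + (a * Real.sin θ * p 0 + p 3 / Real.sin θ)^2

/-- Separated Hamiltonian. -/
def Ham (M a Q : ℝ) (p : Fin 4 → ℝ) (r θ : ℝ) : ℝ :=
  (Rad M a Q p r + Ang a p θ) / Sig M a Q r θ

lemma quad_H (M a Q : ℝ) (x p : Fin 4 → ℝ) (h : Good M a Q (x 1) (x 2)) :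
    quadF4 (fun r θ => (g M a Q r θ)⁻¹) (x, p) = Ham M a Q p (x 1) (x 2) := by
  simp only [quadF4, g_inv M a Q _ _ h]
  obtain ⟨hD, hG, hs, hE⟩ := h
  simp [gi, Fin.sum_univ_four, Ham, Rad, Ang]
  field_simp
  ring

lemma quad_K (M a Q : ℝ) (x p : Fin 4 → ℝ) (h : Good M a Q (x 1) (x 2)) :
    quadF4 (fun r θ =>
            (r * (r - KerrSen.rm M Q)) • (KerrSen.g M a Q r θ)⁻¹
              + (KerrSen.Δ M a Q r)⁻¹ •
                  Matrix.vecMulVec (KerrSen.S M a Q r) (KerrSen.S M a Q r)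
              - KerrSen.Δ M a Q r • Err) (x, p)
      = x 1 * (x 1 - rm M Q) * Ham M a Q p (x 1) (x 2) - Rad M a Q p (x 1) := by
  rw [← quad_H M a Q x p h]
  simp [quadF4, Fin.sum_univ_four, Rad, S, Err]
  ring

lemma good_r (M a Q r θ : ℝ) (h : Good M a Q r θ) : ∀ᶠ r' in nhds r, Good M a Q r' θ := by
  obtain ⟨hD, hG, hs, hE⟩ := h
  have c1 : ContinuousAt (fun r' => Δ M a Q r') r := by unfold Δ; fun_prop
  have c2 : ContinuousAt (fun r' => Sig M a Q r' θ) r := by unfold Sig; fun_prop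
  have c3 : ContinuousAt (fun r' => Δ M a Q r' - a^2 * (Real.sin θ)^2) r := by
    unfold Δ; fun_prop
  filter_upwards [c1.eventually_ne hD, c2.eventually_ne hG, c3.eventually_ne hE] with y h1 h2 h3
  exact ⟨h1, h2, hs, h3⟩

lemma good_θ (M a Q r θ : ℝ) (h : Good M a Q r θ) : ∀ᶠ θ' in nhds θ, Good M a Q r θ' := by
  obtain ⟨hD, hG, hs, hE⟩ := h
  have c1 : ContinuousAt (fun r' => Real.sin r') θ := by fun_prop
  have c2 : ContinuousAt (fun r' => Sig M a Q r r') θ := by unfold Sig; fun_prop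
  have c3 : ContinuousAt (fun r' => Δ M a Q r - a^2 * (Real.sin r')^2) θ := by
    fun_prop
  filter_upwards [c1.eventually_ne hs, c2.eventually_ne hG, c3.eventually_ne hE] with y h1 h2 h3
  exact ⟨hD, h2, h1, h3⟩

lemma quad_pdx0 (K : ℝ → ℝ → Matrix (Fin 4) (Fin 4) ℝ) (z) : pdx 0 (quadF4 K) z = 0 := by
  simp [pdx, quadF4]

lemma quad_pdx3 (K : ℝ → ℝ → Matrix (Fin 4) (Fin 4) ℝ) (z) : pdx 3 (quadF4 K) z = 0 := by
  simp [pdx, quadF4]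

lemma pdx1_eq (M a Q : ℝ) (x p : Fin 4 → ℝ) (h : Good M a Q (x 1) (x 2))
  (F : (Fin 4 → ℝ) × (Fin 4 → ℝ) → ℝ) (G : (Fin 4 → ℝ) → ℝ → ℝ → ℝ)
  (hF : ∀ x p, Good M a Q (x 1) (x 2) → F (x, p) = G p (x 1) (x 2)) :
    pdx 1 F (x, p) = deriv (fun r => G p r (x 2)) (x 1) := by
  unfold pdx
  apply Filter.EventuallyEq.deriv_eq
  filter_upwards [good_r M a Q _ _ h] with y hy
  rw [hF _ _ (by simpa using hy)]
  simp

lemma pdx2_eq (M a Q : ℝ) (x p : Fin 4 → ℝ) (h : Good M a Q (x 1) (x 2))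
  (F : (Fin 4 → ℝ) × (Fin 4 → ℝ) → ℝ) (G : (Fin 4 → ℝ) → ℝ → ℝ → ℝ)
  (hF : ∀ x p, Good M a Q (x 1) (x 2) → F (x, p) = G p (x 1) (x 2)) :
    pdx 2 F (x, p) = deriv (fun θ => G p (x 1) θ) (x 2) := by
  unfold pdx
  apply Filter.EventuallyEq.deriv_eq
  filter_upwards [good_θ M a Q _ _ h] with y hy
  rw [hF _ _ (by simpa using hy)]
  simp

lemma pdp_eq (M a Q : ℝ) (x p : Fin 4 → ℝ) (h : Good M a Q (x 1) (x 2))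
  (F : (Fin 4 → ℝ) × (Fin 4 → ℝ) → ℝ) (G : (Fin 4 → ℝ) → ℝ → ℝ → ℝ)
  (hF : ∀ x p, Good M a Q (x 1) (x 2) → F (x, p) = G p (x 1) (x 2)) (μ : Fin 4) :
    pdp μ F (x, p) = deriv (fun s => G (Function.update p μ s) (x 1) (x 2)) (p μ) := by
  unfold pdp
  congr 1
  ext s
  rw [hF _ _ h]

lemma pH1 (M a Q : ℝ) (p : Fin 4 → ℝ) (r θ : ℝ) :
    HasDerivAt (fun s => Ham M a Q (Function.update p 1 s) r θ)
      (2 * Δ M a Q r * p 1 / Sig M a Q r θ) (p 1) := by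
  simp only [Ham, Rad, Ang]
  simp
  have := ((((((hasDerivAt_id (p 1)).pow 2).const_mul (Δ M a Q r)).sub_const
    (((r * (r - rm M Q) + a^2) * p 0 + a * p 3)^2 / Δ M a Q r)).add_const
    (p 2 ^ 2 + (a * Real.sin θ * p 0 + p 3 / Real.sin θ)^2)).div_const (Sig M a Q r θ))
  refine this.congr_deriv ?_
  simp; ring

lemma pR1 (M a Q : ℝ) (p : Fin 4 → ℝ) (r : ℝ) :
    HasDerivAt (fun s => Rad M a Q (Function.update p 1 s) r)
      (2 * Δ M a Q r * p 1) (p 1) := by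
  simp only [Rad]
  simp
  have := ((hasDerivAt_id (p 1)).pow 2).const_mul (Δ M a Q r)
  refine this.congr_deriv ?_
  simp; ring

lemma Rad_p2 (M a Q : ℝ) (p : Fin 4 → ℝ) (r s : ℝ) :
    Rad M a Q (Function.update p 2 s) r = Rad M a Q p r := by
  simp [Rad]

end KerrSen

/-- The field `K = r(r−r₋)·g⁻¹ + Δ⁻¹·SSᵀ − Δ·E_rr` is a
Killing tensor for the Kerr–Sen metric: `{H, F_K} = 0` on `U × ℝ⁴`. -/
theorem kerr_sen_killing_tensor
    (M a Q : ℝ) (hM : M ≠ 0) :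
    ∀ x : Fin 4 → ℝ,
      KerrSen.Δ M a Q (x 1) ≠ 0 →
      KerrSen.Sig M a Q (x 1) (x 2) ≠ 0 →
      Real.sin (x 2) ≠ 0 →
      KerrSen.Δ M a Q (x 1) - a^2 * (Real.sin (x 2))^2 ≠ 0 →
      ∀ p : Fin 4 → ℝ,
        poisson
          (quadF4 (fun r θ => (KerrSen.g M a Q r θ)⁻¹))
          (quadF4 (fun r θ =>
            (r * (r - KerrSen.rm M Q)) • (KerrSen.g M a Q r θ)⁻¹
              + (KerrSen.Δ M a Q r)⁻¹ •
                  Matrix.vecMulVec (KerrSen.S M a Q r) (KerrSen.S M a Q r)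
              - KerrSen.Δ M a Q r • Err))
          (x, p) = 0 := by
  intro x hD hG hs hE p
  have h : KerrSen.Good M a Q (x 1) (x 2) := ⟨hD, hG, hs, hE⟩
  simp only [poisson, Fin.sum_univ_four, KerrSen.quad_pdx0, KerrSen.quad_pdx3]
  have qH := KerrSen.quad_H M a Q
  have qK := KerrSen.quad_K M a Q
  rw [KerrSen.pdx1_eq M a Q x p h _ _ qH, KerrSen.pdx2_eq M a Q x p h _ _ qH,
    KerrSen.pdp_eq M a Q x p h _ _ qH 1, KerrSen.pdp_eq M a Q x p h _ _ qH 2,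
    KerrSen.pdx1_eq M a Q x p h _
      (fun p r θ => r * (r - KerrSen.rm M Q) * KerrSen.Ham M a Q p r θ - KerrSen.Rad M a Q p r) qK,
    KerrSen.pdx2_eq M a Q x p h _
      (fun p r θ => r * (r - KerrSen.rm M Q) * KerrSen.Ham M a Q p r θ - KerrSen.Rad M a Q p r) qK,
    KerrSen.pdp_eq M a Q x p h _
      (fun p r θ => r * (r - KerrSen.rm M Q) * KerrSen.Ham M a Q p r θ - KerrSen.Rad M a Q p r) qK 1,
    KerrSen.pdp_eq M a Q x p h _
      (fun p r θ => r * (r - KerrSen.rm M Q) * KerrSen.Ham M a Q p r θ - KerrSen.Rad M a Q p r) qK 2]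
  simp only [KerrSen.Rad_p2, deriv_sub_const, deriv_const_mul_field]
  rw [(KerrSen.pH1 M a Q p (x 1) (x 2)).deriv,
    (((KerrSen.pH1 M a Q p (x 1) (x 2)).const_mul (x 1 * (x 1 - KerrSen.rm M Q))).fun_sub
      (KerrSen.pR1 M a Q p (x 1))).deriv]
  have dR : DifferentiableAt ℝ (KerrSen.Rad M a Q p) (x 1) := by
    have : DifferentiableAt ℝ (KerrSen.Δ M a Q) (x 1) := by
      unfold KerrSen.Δ; fun_prop
    unfold KerrSen.Rad
    fun_prop (disch := assumption)
  have hR := dR.hasDerivAt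
  generalize deriv (KerrSen.Rad M a Q p) (x 1) = R' at hR
  have hρ : HasDerivAt (fun r : ℝ => r * (r - KerrSen.rm M Q)) (2 * x 1 - KerrSen.rm M Q) (x 1) := by
    refine ((hasDerivAt_id (x 1)).mul ((hasDerivAt_id (x 1)).sub_const (KerrSen.rm M Q))).congr_deriv ?_
    simp; ring
  have hS : HasDerivAt (fun r : ℝ => KerrSen.Sig M a Q r (x 2)) (2 * x 1 - KerrSen.rm M Q) (x 1) :=
    hρ.add_const _
  have hH : HasDerivAt (fun r => KerrSen.Ham M a Q p r (x 2)) _ (x 1) :=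
    (hR.add_const (KerrSen.Ang a p (x 2))).div hS hG
  rw [hH.deriv, ((hρ.fun_mul hH).fun_sub hR).deriv]
  change _ + (_ - deriv (KerrSen.Ham M a Q p (x 1)) (x 2) * _) + _ = 0
  generalize deriv (KerrSen.Ham M a Q p (x 1)) (x 2) = T1
  generalize deriv (fun s => KerrSen.Ham M a Q (Function.update p 2 s) (x 1) (x 2)) (p 2) = T2
  simp only [KerrSen.Ham]
  field_simp
  ring
end
end
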